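/- arXiv:2601.00256 — 2 statements merged into one kernel-verified Lean document; each statement's English description precedes it below -/
import Mathlib

section
/- Let M be a compact topological space with a finite Borel measure μ, let f : M → ℝ be continuous with f ≥ 0 and with zero set f⁻¹({0}) = {p₁, …, p_N} finite, let U₁, …, U_N be pairwise disjoint open sets with pᵢ ∈ Uᵢ, and let g : M → ℝ be integrable. Then ∫_M e^{−t f} g dμ − Σ_{i=1}^N ∫_{Uᵢ} e^{−t f} g dμ tends to 0 as t → ∞; in fact there exist δ > 0 and C ≥ 0 such that this difference is bounded in absolute value by C e^{−t δ} for all t ≥ 0. -/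
open MeasureTheory Filter

/-- Localization of `∫_M e^{−t f} g dμ` to disjoint open neighborhoods of the
finitely many zeros of a nonnegative continuous function `f` on a compact space `M`, with an
exponentially small error. -/
theorem integral_exp_neg_localizes_to_zero_set
    {M : Type*} [TopologicalSpace M] [CompactSpace M] [MeasurableSpace M] [BorelSpace M]
    (μ : Measure M) [IsFiniteMeasure μ]
    (f : M → ℝ) (hf : Continuous f) (hf0 : ∀ x, 0 ≤ f x)
    (N : ℕ) (p : Fin N → M) (hp : Function.Injective p)
    (hzero : f ⁻¹' {0} = Set.range p)
    (U : Fin N → Set M) (hUopen : ∀ i, IsOpen (U i))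
    (hUdisj : Pairwise (Function.onFun Disjoint U))
    (hpU : ∀ i, p i ∈ U i)
    (g : M → ℝ) (hg : Integrable g μ) :
    Tendsto
      (fun t : ℝ =>
        (∫ x, Real.exp (-t * f x) * g x ∂μ) -
          ∑ i : Fin N, ∫ x in U i, Real.exp (-t * f x) * g x ∂μ)
      atTop (nhds 0) ∧
    ∃ δ > 0, ∃ C ≥ 0, ∀ t : ℝ, 0 ≤ t →
      |(∫ x, Real.exp (-t * f x) * g x ∂μ) -
          ∑ i : Fin N, ∫ x in U i, Real.exp (-t * f x) * g x ∂μ| ≤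
        C * Real.exp (-t * δ) := by
  have key : ∃ δ > 0, ∃ C ≥ 0, ∀ t : ℝ, 0 ≤ t →
      |(∫ x, Real.exp (-t * f x) * g x ∂μ) -
          ∑ i : Fin N, ∫ x in U i, Real.exp (-t * f x) * g x ∂μ| ≤
        C * Real.exp (-t * δ) := by
    have hVo : IsOpen (⋃ i, U i) := isOpen_iUnion hUopen
    have hK : IsCompact (⋃ i, U i)ᶜ := hVo.isClosed_compl.isCompact
    have hδ : ∃ δ > 0, ∀ x ∈ (⋃ i, U i)ᶜ, δ ≤ f x := by
      rcases Set.eq_empty_or_nonempty (⋃ i, U i)ᶜ with h | h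
      · exact ⟨1, one_pos, by simp [h]⟩
      · obtain ⟨x, hx, hmin⟩ := hK.exists_isMinOn h hf.continuousOn
        refine ⟨f x, lt_of_le_of_ne (hf0 x) fun h0 => hx ?_, fun y hy => hmin hy⟩
        have : x ∈ f ⁻¹' {0} := h0.symm
        rw [hzero] at this
        obtain ⟨i, rfl⟩ := this
        exact Set.mem_iUnion.2 ⟨i, hpU i⟩
    obtain ⟨δ, hδ0, hδ⟩ := hδ
    refine ⟨δ, hδ0, ∫ x, |g x| ∂μ, integral_nonneg fun x => abs_nonneg _, fun t ht => ?_⟩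
    have hint : Integrable (fun x => Real.exp (-t * f x) * g x) μ := by
      refine hg.bdd_mul (c := 1) ?_ (Eventually.of_forall fun x => ?_)
      · have : Continuous fun x => Real.exp (-t * f x) := by fun_prop
        exact this.measurable.aestronglyMeasurable
      · rw [Real.norm_eq_abs, Real.abs_exp, Real.exp_le_one_iff]
        nlinarith [mul_nonneg ht (hf0 x)]
    rw [← integral_iUnion_fintype (fun i => (hUopen i).measurableSet) hUdisj
      (fun i => hint.integrableOn), ← integral_add_compl hVo.measurableSet hint,
      add_sub_cancel_left, ← Real.norm_eq_abs]
    calc _ ≤ ∫ x in (⋃ i, U i)ᶜ, |g x| * Real.exp (-t * δ) ∂μ := by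
          refine norm_integral_le_of_norm_le (hg.abs.mul_const _).integrableOn ?_
          filter_upwards [ae_restrict_mem hVo.measurableSet.compl] with x hx
          rw [norm_mul, Real.norm_eq_abs, Real.norm_eq_abs, Real.abs_exp, mul_comm]
          gcongr ?_ * Real.exp ?_
          nlinarith [hδ x hx]
      _ ≤ ∫ x, |g x| * Real.exp (-t * δ) ∂μ :=
          setIntegral_le_integral (hg.abs.mul_const _)
            (Eventually.of_forall fun x => by positivity)
      _ = _ := integral_mul_const _ _
  refine ⟨?_, key⟩
  obtain ⟨δ, hδ, C, _, h⟩ := key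
  have hlim : Tendsto (fun t : ℝ => C * Real.exp (-t * δ)) atTop (nhds 0) := by
    have h1 : Tendsto (fun t : ℝ => -t * δ) atTop atBot :=
      tendsto_neg_atTop_atBot.atBot_mul_const hδ
    simpa using (Real.tendsto_exp_atBot.comp h1).const_mul C
  refine squeeze_zero_norm' ?_ hlim
  filter_upwards [eventually_ge_atTop 0] with t ht
  exact h t ht
end

section
/- Let n ≥ 1, let f : ℝⁿ → ℝ be continuous with f ≥ 0 and finite zero set f⁻¹({0}) = {p₁, …, p_N}. Suppose there are real symmetric positive definite n × n matrices Λ₁, …, Λ_N, and constants r₀ > 0, C ≥ 0, ε > 0 such that for each i: |f(x) − ½⟨x − pᵢ, Λᵢ (x − pᵢ)⟩| ≤ C|x − pᵢ|³ whenever |x − pᵢ| ≤ r₀, and f(x) ≥ ε whenever x has distance ≥ r₀ from every pᵢ. Let g : ℝⁿ → ℝ be bounded, continuous, and integrable with respect to Lebesgue measure. Then t^{n/2} · ∫_{ℝⁿ} e^{−t f(x)} g(x) dx tends to (2π)^{n/2} · Σ_{i=1}^N g(pᵢ) · (det Λᵢ)^{−1/2} as t → ∞. -/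
open MeasureTheory Filter

/-- The Euclidean norm on `ℝⁿ`. -/
noncomputable def euclideanNormR {n : ℕ} (x : Fin n → ℝ) : ℝ :=
  Real.sqrt (∑ i, x i ^ 2)

lemma eN_nonneg {n : ℕ} (x : Fin n → ℝ) : 0 ≤ euclideanNormR x := Real.sqrt_nonneg _
lemma eN_sq {n : ℕ} (x : Fin n → ℝ) : euclideanNormR x ^ 2 = ∑ i, x i ^ 2 :=
  Real.sq_sqrt (Finset.sum_nonneg fun _ _ => sq_nonneg _)
lemma eN_cont {n : ℕ} : Continuous (euclideanNormR (n := n)) := by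
  unfold euclideanNormR; fun_prop
lemma eN_smul {n : ℕ} (c : ℝ) (hc : 0 ≤ c) (x : Fin n → ℝ) :
    euclideanNormR (c • x) = c * euclideanNormR x := by
  unfold euclideanNormR
  simp only [Pi.smul_apply, smul_eq_mul, mul_pow, ← Finset.mul_sum]
  rw [Real.sqrt_mul (sq_nonneg c), Real.sqrt_sq hc]
lemma norm_le_eN {n : ℕ} (x : Fin n → ℝ) : ‖x‖ ≤ euclideanNormR x := by
  refine (pi_norm_le_iff_of_nonneg (eN_nonneg x)).2 fun i => ?_
  refine Real.le_sqrt_of_sq_le ?_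
  rw [Real.norm_eq_abs, sq_abs]
  exact Finset.single_le_sum (f := fun i => x i ^ 2) (fun _ _ => sq_nonneg _) (Finset.mem_univ i)

lemma posDef_factor {n : ℕ} {A : Matrix (Fin n) (Fin n) ℝ} (hA : A.PosDef) :
    ∃ B : Matrix (Fin n) (Fin n) ℝ, B.det ≠ 0 ∧ A = B.transpose * B := by
  open scoped MatrixOrder in
  obtain ⟨B, hB⟩ := CStarAlgebra.nonneg_iff_eq_star_mul_self.1 hA.posSemidef.nonneg
  rw [Matrix.star_eq_conjTranspose, Matrix.conjTranspose_eq_transpose_of_trivial] at hB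
  refine ⟨B, fun h => ?_, hB⟩
  have := hA.det_pos
  rw [hB, Matrix.det_mul, h] at this
  simp at this

lemma quad_factor {n : ℕ} (B : Matrix (Fin n) (Fin n) ℝ) (y : Fin n → ℝ) :
    ∑ j, y j * (B.transpose * B).mulVec y j = ∑ j, (B.mulVec y) j ^ 2 := by
  have : y ⬝ᵥ (B.transpose * B).mulVec y = B.mulVec y ⬝ᵥ B.mulVec y := by
    rw [← Matrix.mulVec_mulVec, Matrix.dotProduct_mulVec, Matrix.vecMul_transpose]
  simpa [dotProduct, sq] using this

lemma quad_lower {n : ℕ} {A : Matrix (Fin n) (Fin n) ℝ} (hA : A.PosDef) :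
    ∃ c : ℝ, 0 < c ∧ ∀ y : Fin n → ℝ, c * euclideanNormR y ^ 2 ≤ ∑ j, y j * A.mulVec y j := by
  obtain ⟨B, hB, rfl⟩ := posDef_factor hA
  set K : ℝ := ∑ i, ∑ j, (B⁻¹ i j) ^ 2 with hK
  have hK0 : 0 ≤ K := by positivity
  refine ⟨(K + 1)⁻¹, by positivity, fun y => ?_⟩
  rw [quad_factor, eN_sq, inv_mul_le_iff₀ (by positivity)]
  set z := B.mulVec y with hz
  have hy : y = B⁻¹.mulVec z := by
    rw [hz, Matrix.mulVec_mulVec, Matrix.nonsing_inv_mul _ (isUnit_iff_ne_zero.2 hB),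
      Matrix.one_mulVec]
  have h1 : ∑ i, y i ^ 2 ≤ K * ∑ j, z j ^ 2 := by
    rw [hK, Finset.sum_mul]
    refine Finset.sum_le_sum fun i _ => ?_
    conv_lhs => rw [hy]
    exact Finset.sum_mul_sq_le_sq_mul_sq Finset.univ (fun j => B⁻¹ i j) z
  have h2 : 0 ≤ ∑ j, z j ^ 2 := by positivity
  linarith

lemma gauss_integrable {n : ℕ} {c : ℝ} (hc : 0 < c) :
    Integrable (fun y : Fin n → ℝ => Real.exp (-c * euclideanNormR y ^ 2)) := by
  have h := Integrable.fintype_prod (ι := Fin n) (𝕜 := ℝ) (E := ℝ)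
    (f := fun _ (x : ℝ) => Real.exp (-c * x ^ 2)) (μ := fun _ => volume)
    (fun _ => integrable_exp_neg_mul_sq hc)
  refine h.congr (ae_of_all _ fun y => ?_)
  simp only [eN_sq, Finset.mul_sum, Real.exp_sum]

lemma gauss_integral {n : ℕ} {A : Matrix (Fin n) (Fin n) ℝ} (hA : A.PosDef) :
    ∫ y : Fin n → ℝ, Real.exp (-((1 / 2) * ∑ j, y j * A.mulVec y j)) =
      (2 * Real.pi) ^ ((n : ℝ) / 2) * A.det ^ (-(1 : ℝ) / 2) := by
  obtain ⟨B, hB, rfl⟩ := posDef_factor hA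
  simp_rw [quad_factor]
  have hm := Real.map_matrix_volume_pi_eq_smul_volume_pi hB
  have h1 : ∫ y : Fin n → ℝ, Real.exp (-((1 / 2) * ∑ j, B.mulVec y j ^ 2)) =
      ∫ z, Real.exp (-((1 / 2) * ∑ j, z j ^ 2)) ∂(Measure.map (Matrix.toLin' B) volume) := by
    rw [integral_map]
    · rfl
    · exact (LinearMap.continuous_of_finiteDimensional _).aemeasurable
    · exact Continuous.aestronglyMeasurable (by fun_prop)
  have h2 : ∫ z : Fin n → ℝ, Real.exp (-((1 / 2) * ∑ j, z j ^ 2)) =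
      (2 * Real.pi) ^ ((n : ℝ) / 2) := by
    have h := integral_fintype_prod_volume_eq_pow (ι := Fin n) (𝕜 := ℝ)
      (fun x : ℝ => Real.exp (-(1/2) * x ^ 2))
    rw [integral_gaussian] at h
    have e : ∀ z : Fin n → ℝ, Real.exp (-((1 / 2) * ∑ j, z j ^ 2)) =
        ∏ i, Real.exp (-(1/2) * z i ^ 2) := by
      intro z; rw [← Real.exp_sum, ← Finset.mul_sum, neg_mul]
    simp_rw [e]
    rw [h, Fintype.card_fin, Real.sqrt_eq_rpow, ← Real.rpow_natCast, ← Real.rpow_mul (by positivity)]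
    congr 1 <;> ring
  rw [h1, hm, integral_smul_measure, h2, ENNReal.toReal_ofReal (abs_nonneg _), smul_eq_mul, mul_comm]
  congr 1
  rw [Matrix.det_mul, Matrix.det_transpose, ← sq, ← sq_abs, ← Real.rpow_natCast, ← Real.rpow_mul (abs_nonneg _),
    abs_inv]
  norm_num [Real.rpow_neg_one]

lemma local_piece {n : ℕ} {f g : (Fin n → ℝ) → ℝ} (hf : Continuous f) (hg : Continuous g)
    {A : Matrix (Fin n) (Fin n) ℝ} (hA : A.PosDef) (p : Fin n → ℝ)
    {C c δ B : ℝ} (hC : 0 ≤ C) (hc : 0 < c) (hδ : 0 < δ)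
    (hcl : ∀ y : Fin n → ℝ, c * euclideanNormR y ^ 2 ≤ ∑ j, y j * A.mulVec y j)
    (hCδ : C * δ ≤ c / 4) (hB : ∀ x, |g x| ≤ B)
    (hq : ∀ x : Fin n → ℝ, euclideanNormR (x - p) ≤ δ →
      |f x - (1 / 2) * ∑ j, (x - p) j * A.mulVec (x - p) j| ≤ C * euclideanNormR (x - p) ^ 3) :
    Tendsto (fun t : ℝ => t ^ ((n : ℝ) / 2) *
        ∫ x in {x | euclideanNormR (x - p) < δ}, Real.exp (-t * f x) * g x)
      atTop (nhds ((2 * Real.pi) ^ ((n : ℝ) / 2) * (g p * A.det ^ (-(1 : ℝ) / 2)))) := by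
  have hS : MeasurableSet {x : Fin n → ℝ | euclideanNormR (x - p) < δ} :=
    (isOpen_lt (eN_cont.comp (by fun_prop)) continuous_const).measurableSet
  set S := {x : Fin n → ℝ | euclideanNormR (x - p) < δ} with hSdef
  have hlim : (2 * Real.pi) ^ ((n : ℝ) / 2) * (g p * A.det ^ (-(1 : ℝ) / 2)) =
      ∫ y : Fin n → ℝ, Real.exp (-((1 / 2) * ∑ j, y j * A.mulVec y j)) * g p := by
    rw [integral_mul_const, gauss_integral hA]; ring
  rw [hlim]
  let F : ℝ → (Fin n → ℝ) → ℝ := fun t =>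
    fun y => S.indicator (fun x => Real.exp (-t * f x) * g x) (p + (Real.sqrt t)⁻¹ • y)
  have hquadsm : ∀ (s : ℝ) (y : Fin n → ℝ), ∑ j, (s • y) j * A.mulVec (s • y) j =
      s ^ 2 * ∑ j, y j * A.mulVec y j := by
    intro s y
    rw [Matrix.mulVec_smul, Finset.mul_sum]
    refine Finset.sum_congr rfl fun j _ => ?_
    simp only [Pi.smul_apply, smul_eq_mul]; ring
  -- basic estimate
  have key : ∀ t : ℝ, 0 < t → ∀ y : Fin n → ℝ, (Real.sqrt t)⁻¹ * euclideanNormR y < δ →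
      |t * f (p + (Real.sqrt t)⁻¹ • y) - (1 / 2) * ∑ j, y j * A.mulVec y j| ≤
        C * ((Real.sqrt t)⁻¹ * euclideanNormR y) * euclideanNormR y ^ 2 := by
    intro t ht y hy
    have hs : 0 < Real.sqrt t := Real.sqrt_pos.2 ht
    have ht2 : t * ((Real.sqrt t)⁻¹) ^ 2 = 1 := by
      rw [inv_pow, Real.sq_sqrt ht.le]; exact mul_inv_cancel₀ ht.ne'
    have h := hq (p + (Real.sqrt t)⁻¹ • y) (by
      rw [add_sub_cancel_left, eN_smul _ (by positivity)]; exact hy.le)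
    rw [add_sub_cancel_left, eN_smul _ (by positivity), hquadsm] at h
    set s := (Real.sqrt t)⁻¹ with hsd
    have e1 : t * f (p + s • y) - (1 / 2) * ∑ j, y j * A.mulVec y j =
        t * (f (p + s • y) - (1 / 2) * (s ^ 2 * ∑ j, y j * A.mulVec y j)) := by
      linear_combination (1 / 2 * ∑ j, y j * A.mulVec y j) * ht2
    rw [e1, abs_mul, abs_of_pos ht]
    calc _ ≤ t * (C * (s * euclideanNormR y) ^ 3) := by gcongr
      _ = (t * s ^ 2) * (C * (s * euclideanNormR y) * euclideanNormR y ^ 2) := by ring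
      _ = _ := by rw [ht2, one_mul]
  have hmem : ∀ (t : ℝ) (y : Fin n → ℝ), p + (Real.sqrt t)⁻¹ • y ∈ S ↔
      (Real.sqrt t)⁻¹ * euclideanNormR y < δ := by
    intro t y
    rw [hSdef, Set.mem_ofPred_eq, add_sub_cancel_left, eN_smul _ (by positivity)]
  have hsq : Tendsto (fun t : ℝ => (Real.sqrt t)⁻¹) atTop (nhds 0) :=
    tendsto_inv_atTop_zero.comp Real.tendsto_sqrt_atTop
  have hB0 : 0 ≤ B := (abs_nonneg _).trans (hB p)
  have hdom : Tendsto (fun t => ∫ y, F t y) atTop (nhds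
      (∫ y : Fin n → ℝ, Real.exp (-((1 / 2) * ∑ j, y j * A.mulVec y j)) * g p)) := by
    refine tendsto_integral_filter_of_dominated_convergence
      (fun y => Real.exp (-(c / 4) * euclideanNormR y ^ 2) * B) ?_ ?_ ?_ ?_
    · refine Eventually.of_forall fun t => ?_
      refine Measurable.aestronglyMeasurable ?_
      have hm1 : Measurable (S.indicator (fun x => Real.exp (-t * f x) * g x)) :=
        Measurable.indicator (Continuous.measurable (by fun_prop)) hS
      have hm2 : Measurable (fun y : Fin n → ℝ => p + (Real.sqrt t)⁻¹ • y) :=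
        Continuous.measurable (by fun_prop)
      exact hm1.comp hm2
    · filter_upwards [eventually_gt_atTop 0] with t ht
      refine ae_of_all _ fun y => ?_
      by_cases hy : p + (Real.sqrt t)⁻¹ • y ∈ S
      · simp only [F, Set.indicator_of_mem hy, norm_mul, Real.norm_eq_abs, Real.abs_exp]
        have hy' := (hmem t y).1 hy
        have h1 := (abs_le.1 (key t ht y hy')).1
        have h2 := hcl y
        have h3 : C * ((Real.sqrt t)⁻¹ * euclideanNormR y) * euclideanNormR y ^ 2 ≤
            c / 4 * euclideanNormR y ^ 2 := by
          refine mul_le_mul_of_nonneg_right ?_ (sq_nonneg _)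
          exact (mul_le_mul_of_nonneg_left hy'.le hC).trans hCδ
        refine mul_le_mul (Real.exp_le_exp.2 ?_) (hB _) (abs_nonneg _) (Real.exp_pos _).le
        have h4 : 0 ≤ c * euclideanNormR y ^ 2 := by positivity
        linarith
      · simp only [F, Set.indicator_of_notMem hy, norm_zero]
        positivity
    · exact (gauss_integrable (by positivity)).mul_const B
    · refine ae_of_all _ fun y => ?_
      have hsy : Tendsto (fun t : ℝ => (Real.sqrt t)⁻¹ * euclideanNormR y) atTop (nhds 0) := by
        simpa using hsq.mul_const (euclideanNormR y)
      have hev : ∀ᶠ t : ℝ in atTop, (Real.sqrt t)⁻¹ * euclideanNormR y < δ :=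
        hsy.eventually (gt_mem_nhds hδ)
      have hx : Tendsto (fun t : ℝ => p + (Real.sqrt t)⁻¹ • y) atTop (nhds p) := by
        simpa using (tendsto_const_nhds (x := p)).add (hsq.smul_const y)
      have hgx := (hg.tendsto p).comp hx
      have hfx : Tendsto (fun t : ℝ => t * f (p + (Real.sqrt t)⁻¹ • y)) atTop
          (nhds ((1 / 2) * ∑ j, y j * A.mulVec y j)) := by
        rw [tendsto_iff_norm_sub_tendsto_zero]
        have hb : Tendsto (fun t : ℝ => C * ((Real.sqrt t)⁻¹ * euclideanNormR y) *
            euclideanNormR y ^ 2) atTop (nhds 0) := by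
          simpa using (hsy.const_mul C).mul_const (euclideanNormR y ^ 2)
        refine squeeze_zero' (Eventually.of_forall fun _ => norm_nonneg _) ?_ hb
        filter_upwards [hev, eventually_gt_atTop 0] with t h1 h2
        exact key t h2 y h1
      have hm := ((Real.continuous_exp.tendsto _).comp hfx.neg).mul hgx
      refine hm.congr' ?_
      filter_upwards [hev] with t h1
      simp only [F, Set.indicator_of_mem ((hmem t y).2 h1), Function.comp, neg_mul]
  refine hdom.congr' ?_
  filter_upwards [eventually_gt_atTop 0] with t ht
  have hs : 0 < Real.sqrt t := Real.sqrt_pos.2 ht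
  simp only [F]
  rw [Measure.integral_comp_smul volume
    (fun x => S.indicator (fun x => Real.exp (-t * f x) * g x) (p + x)) (Real.sqrt t)⁻¹,
    integral_add_left_eq_self (S.indicator (fun x => Real.exp (-t * f x) * g x)) p,
    integral_indicator hS, smul_eq_mul]
  congr 1
  rw [Module.finrank_fin_fun, inv_pow, inv_inv, abs_of_pos (by positivity), Real.sqrt_eq_rpow,
    ← Real.rpow_natCast, ← Real.rpow_mul ht.le]
  congr 1; ring

/-- Laplace-type localization on `ℝⁿ`: if the nonnegative continuous function
`f` vanishes exactly at the finitely many points `p₁, …, p_N`, near each `pᵢ` equals the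
positive definite quadratic form `½⟨x−pᵢ, Λᵢ(x−pᵢ)⟩` up to a cubic error, and is `≥ ε` away
from the `pᵢ`, then for bounded continuous integrable `g`,
`t^{n/2} ∫ e^{−tf} g → (2π)^{n/2} Σᵢ g(pᵢ) (det Λᵢ)^{−1/2}` as `t → ∞`. -/
theorem laplace_localization_at_isolated_zeros
    (n : ℕ) (hn : 1 ≤ n)
    (f : (Fin n → ℝ) → ℝ) (hfcont : Continuous f) (hf0 : ∀ x, 0 ≤ f x)
    (N : ℕ) (p : Fin N → (Fin n → ℝ)) (hp : Function.Injective p)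
    (hzero : f ⁻¹' {0} = Set.range p)
    (Λ : Fin N → Matrix (Fin n) (Fin n) ℝ)
    (hsymm : ∀ i, (Λ i).IsSymm) (hpos : ∀ i, (Λ i).PosDef)
    (r₀ C ε : ℝ) (hr₀ : 0 < r₀) (hC : 0 ≤ C) (hε : 0 < ε)
    (hquad : ∀ i, ∀ x : Fin n → ℝ, euclideanNormR (x - p i) ≤ r₀ →
      |f x - (1 / 2) * ∑ j, (x - p i) j * (Λ i).mulVec (x - p i) j| ≤
        C * euclideanNormR (x - p i) ^ 3)
    (hfar : ∀ x : Fin n → ℝ, (∀ i, r₀ ≤ euclideanNormR (x - p i)) → ε ≤ f x)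
    (g : (Fin n → ℝ) → ℝ)
    (hbdd : ∃ B : ℝ, ∀ x, |g x| ≤ B)
    (hgcont : Continuous g)
    (hint : Integrable g volume) :
    Tendsto
      (fun t : ℝ =>
        t ^ ((n : ℝ) / 2) * ∫ x : Fin n → ℝ, Real.exp (-t * f x) * g x ∂volume)
      atTop
      (nhds ((2 * Real.pi) ^ ((n : ℝ) / 2) *
        ∑ i, g (p i) * (Λ i).det ^ (-(1 : ℝ) / 2))) := by
  obtain ⟨B, hB⟩ := hbdd
  choose c hc hcl using fun i => quad_lower (hpos i)
  -- choice of the radius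
  obtain ⟨δ, hδ, hδr, hδc, hδd⟩ : ∃ δ : ℝ, 0 < δ ∧ δ ≤ r₀ ∧ (∀ i, C * δ ≤ c i / 4) ∧
      ∀ i j, i ≠ j → 2 * δ ≤ ‖p i - p j‖ := by
    have lin : ∀ a b : ℝ, 0 < b → ∀ᶠ δ in nhdsWithin (0:ℝ) (Set.Ioi 0), a * δ ≤ b := by
      intro a b hb
      have : Tendsto (fun δ : ℝ => a * δ) (nhds 0) (nhds 0) := by
        simpa using (continuous_const_mul a).tendsto (0:ℝ)
      exact ((this.eventually (gt_mem_nhds hb)).filter_mono nhdsWithin_le_nhds).mono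
        fun _ h => le_of_lt h
    have h1 : ∀ᶠ δ in nhdsWithin (0:ℝ) (Set.Ioi 0), 0 < δ := eventually_mem_nhdsWithin
    have h2 := lin 1 r₀ hr₀
    have h3 := eventually_all.2 fun i => lin C (c i / 4) (by have := hc i; positivity)
    have h4 : ∀ᶠ δ in nhdsWithin (0:ℝ) (Set.Ioi 0), ∀ i j, i ≠ j → 2 * δ ≤ ‖p i - p j‖ := by
      refine eventually_all.2 fun i => eventually_all.2 fun j => ?_
      by_cases hij : i = j
      · exact Eventually.of_forall fun _ h => absurd hij h
      · exact (lin 2 _ (norm_pos_iff.2 (sub_ne_zero.2 (hp.ne hij)))).mono fun _ h _ => h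
    obtain ⟨δ, a1, a2, a3, a4⟩ := (h1.and (h2.and (h3.and h4))).exists
    exact ⟨δ, a1, by simpa using a2, a3, a4⟩
  set S : Fin N → Set (Fin n → ℝ) := fun i => {x | euclideanNormR (x - p i) < δ} with hSdef
  have hcx : ∀ i, Continuous fun x : Fin n → ℝ => euclideanNormR (x - p i) := fun i =>
    eN_cont.comp (by fun_prop)
  have hSo : ∀ i, IsOpen (S i) := fun i => isOpen_lt (hcx i) continuous_const
  have hSd : Pairwise (Function.onFun Disjoint S) := by
    intro i j hij
    refine Set.disjoint_left.2 fun x hi hj => ?_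
    have h1 := (norm_le_eN (x - p i)).trans_lt hi
    have h2 := (norm_le_eN (x - p j)).trans_lt hj
    have h3 : ‖p i - p j‖ ≤ ‖x - p j‖ + ‖x - p i‖ := by
      have := norm_sub_le (x - p j) (x - p i)
      rwa [sub_sub_sub_cancel_left] at this
    have := hδd i j hij
    linarith
  -- lower bound away from the balls
  obtain ⟨η, hη, hηf⟩ : ∃ η : ℝ, 0 < η ∧ ∀ x ∈ (⋃ i, S i)ᶜ, η ≤ f x := by
    set K : Set (Fin n → ℝ) := (⋃ i, Metric.closedBall (p i) r₀) ∩ (⋃ i, S i)ᶜ with hK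
    have hKc : IsCompact K :=
      (isCompact_iUnion fun i => isCompact_closedBall _ _).inter_right
        (isOpen_iUnion hSo).isClosed_compl
    have hposK : ∀ x ∈ K, 0 < f x := by
      intro x hx
      refine lt_of_le_of_ne (hf0 x) fun h => hx.2 ?_
      have : x ∈ f ⁻¹' {0} := h.symm
      rw [hzero] at this
      obtain ⟨i, rfl⟩ := this
      refine Set.mem_iUnion.2 ⟨i, ?_⟩
      simp [hSdef, euclideanNormR, hδ]
    obtain ⟨m, hm, hmK⟩ : ∃ m : ℝ, 0 < m ∧ ∀ x ∈ K, m ≤ f x := by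
      rcases K.eq_empty_or_nonempty with h | h
      · exact ⟨1, one_pos, by simp [h]⟩
      · obtain ⟨x, hx, hmin⟩ := hKc.exists_isMinOn h hfcont.continuousOn
        exact ⟨f x, hposK x hx, fun y hy => hmin hy⟩
    refine ⟨min m ε, lt_min hm hε, fun x hx => ?_⟩
    by_cases h : ∀ i, r₀ ≤ euclideanNormR (x - p i)
    · exact (min_le_right _ _).trans (hfar x h)
    · push Not at h
      obtain ⟨i, hi⟩ := h
      refine (min_le_left _ _).trans (hmK x ⟨Set.mem_iUnion.2 ⟨i, ?_⟩, hx⟩)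
      rw [Metric.mem_closedBall, dist_eq_norm]
      exact (norm_le_eN _).trans hi.le
  have hUm : MeasurableSet (⋃ i, S i) := (isOpen_iUnion hSo).measurableSet
  have hI : ∀ t : ℝ, 0 < t → Integrable (fun x => Real.exp (-t * f x) * g x) := by
    intro t ht
    refine hint.mono (Continuous.aestronglyMeasurable (by fun_prop)) (ae_of_all _ fun x => ?_)
    rw [norm_mul, Real.norm_eq_abs, Real.abs_exp]
    refine mul_le_of_le_one_left (norm_nonneg _) (Real.exp_le_one_iff.2 ?_)
    have := mul_nonneg ht.le (hf0 x)
    linarith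
  have hloc := tendsto_finsetSum Finset.univ fun i (_ : i ∈ Finset.univ) =>
    local_piece hfcont hgcont (hpos i) (p i) hC (hc i) hδ (hcl i) (hδc i) hB
      (fun x hx => hquad i x (hx.trans hδr))
  have hrest : Tendsto (fun t : ℝ => t ^ ((n : ℝ) / 2) *
      ∫ x in (⋃ i, S i)ᶜ, Real.exp (-t * f x) * g x) atTop (nhds 0) := by
    have hb := (tendsto_rpow_mul_exp_neg_mul_atTop_nhds_zero ((n : ℝ) / 2) η hη).mul_const
      (∫ x, |g x|)
    rw [zero_mul] at hb
    refine squeeze_zero_norm' ?_ hb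
    filter_upwards [eventually_gt_atTop 0] with t ht
    rw [norm_mul, Real.norm_of_nonneg (Real.rpow_nonneg ht.le _), mul_assoc]
    refine mul_le_mul_of_nonneg_left ?_ (Real.rpow_nonneg ht.le _)
    calc ‖∫ x in (⋃ i, S i)ᶜ, Real.exp (-t * f x) * g x‖
        ≤ ∫ x in (⋃ i, S i)ᶜ, Real.exp (-η * t) * |g x| := by
          refine norm_integral_le_of_norm_le (hint.abs.const_mul _).integrableOn ?_
          refine (ae_restrict_iff' hUm.compl).2 (ae_of_all _ fun x hx => ?_)
          rw [norm_mul, Real.norm_eq_abs, Real.abs_exp, Real.norm_eq_abs]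
          refine mul_le_mul_of_nonneg_right (Real.exp_le_exp.2 ?_) (abs_nonneg _)
          have := mul_le_mul_of_nonneg_left (hηf x hx) ht.le
          linarith
      _ ≤ ∫ x, Real.exp (-η * t) * |g x| :=
          setIntegral_le_integral (hint.abs.const_mul _)
            (ae_of_all _ fun x => by positivity)
      _ = _ := integral_const_mul _ _
  have hsum := hloc.add hrest
  rw [add_zero, ← Finset.mul_sum] at hsum
  refine hsum.congr' ?_
  filter_upwards [eventually_gt_atTop 0] with t ht
  rw [← integral_add_compl hUm (hI t ht),
    integral_iUnion_fintype (fun i => (hSo i).measurableSet) hSd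
      (fun i => (hI t ht).integrableOn), mul_add, Finset.mul_sum]
end
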